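/- Let c be a real number and let Q be a polynomial with real coefficients of degree m with positive leading coefficient, all of whose complex roots are real and at least c. Then every coefficient of the polynomial (-1)^m · Q(c - X) (the composition of Q with c - X, multiplied by (-1)^m) is nonnegative. -/

import Mathlib

open Polynomial

theorem aux_prod_coeff_nonneg (c : ℝ) (s : Multiset ℝ) (hs : ∀ r ∈ s, c ≤ r) :
    ∀ i : ℕ, 0 ≤ ((-1 : ℝ[X]) ^ (Multiset.card s) *
      (s.map (fun a => X - C a)).prod.comp (C c - X)).coeff i := by
  induction s using Multiset.induction_on with
  | empty =>
    intro i
    simp only [Multiset.card_zero, pow_zero, Multiset.map_zero, Multiset.prod_zero, one_comp,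
      mul_one, coeff_one]
    split_ifs <;> norm_num
  | cons a s ih =>
    intro i
    have ih' := ih (fun r hr => hs r (Multiset.mem_cons_of_mem hr))
    have ha : c ≤ a := hs a (Multiset.mem_cons_self a s)
    have key : (-1 : ℝ[X]) ^ (Multiset.card (a ::ₘ s)) *
        ((a ::ₘ s).map (fun a => X - C a)).prod.comp (C c - X) =
        ((-1 : ℝ[X]) ^ (Multiset.card s) *
          (s.map (fun a => X - C a)).prod.comp (C c - X)) * (X + C (a - c)) := by
      simp only [Multiset.card_cons, Multiset.map_cons, Multiset.prod_cons, mul_comp, sub_comp,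
        X_comp, C_comp, C_sub, pow_succ]
      ring
    rw [key, mul_add, coeff_add, coeff_mul_C]
    have h2 := mul_nonneg (ih' i) (sub_nonneg.2 ha)
    cases i with
    | zero => rw [coeff_mul_X_zero]; linarith
    | succ n => rw [coeff_mul_X]; exact add_nonneg (ih' n) h2

/-- If a real polynomial `Q` of degree `m` has positive leading coefficient and all of its
complex roots are real and at least `c`, then every coefficient of `(-1)^m * Q(c - X)` is
nonnegative. -/
theorem neg_one_pow_mul_comp_C_sub_X_coeff_nonneg
    (c : ℝ) (m : ℕ) (Q : ℝ[X]) (hdeg : Q.natDegree = m) (hlc : 0 < Q.leadingCoeff)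
    (hroots : ∀ z : ℂ, (Q.map (algebraMap ℝ ℂ)).IsRoot z → z.im = 0 ∧ c ≤ z.re) :
    ∀ i : ℕ, 0 ≤ ((-1 : ℝ[X]) ^ m * Q.comp (Polynomial.C c - Polynomial.X)).coeff i := by
  have hQ : Q.Splits := by
    refine Splits.of_splits_map (algebraMap ℝ ℂ) (IsAlgClosed.splits _) ?_
    intro z hz
    have h := hroots z (isRoot_of_mem_roots hz)
    exact ⟨z.re, Complex.ext (by simp) (by simp [h.1])⟩
  have hr : ∀ r ∈ Q.roots, c ≤ r := by
    intro r hr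
    have h := hroots (algebraMap ℝ ℂ r) ((isRoot_of_mem_roots hr).map)
    simpa using h.2
  intro i
  have hcard : Multiset.card Q.roots = m := by
    rw [← hdeg]; exact splits_iff_card_roots.1 hQ
  have h := aux_prod_coeff_nonneg c Q.roots hr i
  rw [hcard] at h
  have e : (-1 : ℝ[X]) ^ m * Q.comp (C c - X) = C Q.leadingCoeff *
      ((-1 : ℝ[X]) ^ m * (Q.roots.map (fun a => X - C a)).prod.comp (C c - X)) := by
    conv_lhs => rw [hQ.eq_prod_roots]
    rw [mul_comp, C_comp]
    ring
  rw [e, coeff_C_mul]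
  exact mul_nonneg hlc.le h
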